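/- arXiv:2605.08859 — 3 statements merged into one kernel-verified Lean document; each statement's English description precedes it below -/
import Mathlib

section
/- Let α ∈ [1/4, 3/11] and let n ≥ 1 be an integer. For m ∈ {n, 2n} define the sequence γ_m : ℕ → ℝ by γ_m(1) = 1 and γ_m(i+1) = (1 − (1−α)/(2(γ_m(i) − α)·m))·γ_m(i) for i ≥ 1. If γ_{2n}(2n) > α + (1 − α + √(16nα(1−α) + (1−α)²))/(8n), then γ_{2n}(2n) ≤ γ_n(n). -/
/-- The recursively defined sequence: `γ_m 1 = 1` and
`γ_m (i+1) = (1 - (1-α)/(2(γ_m i - α)·m))·γ_m i` for `i ≥ 1`. -/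
noncomputable def gam (α : ℝ) (m : ℕ) : ℕ → ℝ
  | 0 => 1
  | 1 => 1
  | i + 2 => (1 - (1 - α) / (2 * (gam α m (i + 1) - α) * m)) * gam α m (i + 1)

lemma gam_succ (α : ℝ) (m : ℕ) (hm : 1 ≤ m) (k : ℕ) (h : α < gam α m (k + 1)) :
    gam α m (k + 2) = gam α m (k + 1)
      - (1 - α) / (2 * m) * gam α m (k + 1) / (gam α m (k + 1) - α) := by
  rw [gam]
  have h1 : gam α m (k + 1) - α ≠ 0 := by linarith
  have h2 : (m : ℝ) ≠ 0 := by positivity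
  field_simp

lemma log_alpha (α : ℝ) (h0 : 0 < α) (h : α ≤ 3 / 11) :
    α - α * Real.log α ≤ (1 + α) / 2 := by
  have e1 : Real.log (11 / 3) ≤ 4 / 3 := by
    rw [Real.log_le_iff_le_exp (by norm_num)]
    have := Real.sum_le_exp_of_nonneg (x := 4 / 3) (by norm_num) 6
    refine le_trans ?_ this
    norm_num [Finset.sum_range_succ, Nat.factorial]
  have e2 : Real.log (3 / (11 * α)) ≤ 3 / (11 * α) - 1 :=
    Real.log_le_sub_one_of_pos (by positivity)
  have e3 : Real.log (3 / (11 * α)) = - Real.log (11 / 3) - Real.log α := by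
    rw [← Real.log_inv, ← Real.log_div (by norm_num) h0.ne']
    congr 1
    field_simp
  have e4 : -Real.log α ≤ 1 / 3 + 3 / (11 * α) := by linarith
  have e5 : α * (-Real.log α) ≤ α * (1 / 3 + 3 / (11 * α)) :=
    mul_le_mul_of_nonneg_left e4 h0.le
  have e6 : α * (1 / 3 + 3 / (11 * α)) = α / 3 + 3 / 11 := by field_simp
  linarith

lemma sq_gt (α c x : ℝ) (h0 : 0 < α) (hc : 0 < c) (hx : α < x)
    (h : α - α * Real.log α + c ≤ x - α * Real.log x) : c * x < (x - α) ^ 2 := by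
  by_contra! hh
  have hu : 0 < x - α := by linarith
  have e1 := Real.le_log_one_add_of_nonneg (x := (x - α) / α) (by positivity)
  have e2 : Real.log (1 + (x - α) / α) = Real.log x - Real.log α := by
    rw [← Real.log_div (by linarith) h0.ne']
    congr 1
    field_simp
    ring
  rw [e2] at e1
  have e3 : 2 * ((x - α) / α) / ((x - α) / α + 2) = 2 * (x - α) / (x + α) := by
    have : x + α ≠ 0 := by linarith
    have : (x - α) / α + 2 = (x + α) / α := by field_simp; ring
    rw [this]
    field_simp
  rw [e3] at e1
  have e4 := mul_le_mul_of_nonneg_left e1 h0.le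
  have e5 : c ≤ (x - α) - α * (2 * (x - α) / (x + α)) := by linarith
  have e6 : (x - α) - α * (2 * (x - α) / (x + α)) = (x - α) ^ 2 / (x + α) := by
    have : x + α ≠ 0 := by linarith
    field_simp
    ring
  rw [e6, le_div_iff₀ (by linarith)] at e5
  nlinarith [mul_pos hc h0]

lemma step_lem (α c x : ℝ) (h0 : 0 < α) (hx : α < x) (h : c * x < (x - α) ^ 2) :
    α < x - c * x / (x - α) ∧
      x - α * Real.log x - c ≤
        (x - c * x / (x - α)) - α * Real.log (x - c * x / (x - α)) := by
  have hu : 0 < x - α := by linarith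
  have hx0 : 0 < x := by linarith
  have h1 : c * x / (x - α) < x - α := by
    rw [div_lt_iff₀ hu]; nlinarith
  have h2 : α < x - c * x / (x - α) := by linarith
  refine ⟨h2, ?_⟩
  set F := x - c * x / (x - α) with hF
  have hF0 : 0 < F := by linarith
  have e1 : Real.log (F / x) ≤ F / x - 1 := Real.log_le_sub_one_of_pos (by positivity)
  rw [Real.log_div hF0.ne' hx0.ne'] at e1
  have e2 : F / x - 1 = - (c / (x - α)) := by
    rw [hF]; field_simp; ring
  rw [e2] at e1
  have e3 := mul_le_mul_of_nonneg_left e1 h0.le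
  have e4 : c * x / (x - α) = c + α * (c / (x - α)) := by
    field_simp; ring
  linarith

lemma gam_inv (α : ℝ) (h0 : 0 < α) (hα2 : α ≤ 3 / 11) (m : ℕ) (hm : 1 ≤ m) (k : ℕ)
    (hk : k < m) : α < gam α m (k + 1) ∧
      1 - k * ((1 - α) / (2 * m)) ≤ gam α m (k + 1) - α * Real.log (gam α m (k + 1)) ∧
      (1 - α) / (2 * m) * gam α m (k + 1) < (gam α m (k + 1) - α) ^ 2 := by
  have hm0 : (0 : ℝ) < m := by positivity
  have hc : 0 < (1 - α) / (2 * m) := div_pos (by linarith) (by positivity)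
  have key : ∀ x : ℝ, α < x → 1 - k * ((1 - α) / (2 * m)) ≤ x - α * Real.log x →
      (1 - α) / (2 * m) * x < (x - α) ^ 2 := by
    intro x hx hh
    apply sq_gt α _ x h0 hc hx
    have e1 := log_alpha α h0 hα2
    have e2 : (m : ℝ) * ((1 - α) / (2 * m)) = (1 - α) / 2 := by field_simp
    have e3 : (k : ℝ) + 1 ≤ m := by exact_mod_cast hk
    have e4 := mul_le_mul_of_nonneg_right e3 hc.le
    linarith
  suffices hs : α < gam α m (k + 1) ∧
      1 - k * ((1 - α) / (2 * m)) ≤ gam α m (k + 1) - α * Real.log (gam α m (k + 1)) from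
    ⟨hs.1, hs.2, key _ hs.1 hs.2⟩
  clear key
  cases k with
  | zero =>
    simp [gam]
    linarith
  | succ k =>
    obtain ⟨i1, i2, i3⟩ := gam_inv α h0 hα2 m hm k (by omega)
    obtain ⟨s1, s2⟩ := step_lem α _ _ h0 i1 i3
    rw [gam_succ α m hm k i1]
    refine ⟨s1, ?_⟩
    push_cast
    linarith

lemma phi_anti (α c x y : ℝ) (h0 : 0 < α) (hc : 0 < c) (hx : α < x) (hxy : x ≤ y) :
    c * y / (y - α) ≤ c * x / (x - α) := by
  rw [div_le_div_iff₀ (by linarith) (by linarith)]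
  nlinarith [mul_nonneg (mul_pos hc h0).le (sub_nonneg.2 hxy)]

lemma gam_cmp (α : ℝ) (h0 : 0 < α) (hα2 : α ≤ 3 / 11) (n : ℕ) (hn : 1 ≤ n) (i : ℕ)
    (hi : i < n) : gam α (2 * n) (2 * i + 1) ≤ gam α n (i + 1) := by
  induction i with
  | zero => simp [gam]
  | succ i ih =>
    have ih := ih (by omega)
    have hn0 : (0 : ℝ) < n := by positivity
    obtain ⟨y1, -, -⟩ := gam_inv α h0 hα2 (2 * n) (by omega) (2 * i) (by omega)
    obtain ⟨z1, -, -⟩ := gam_inv α h0 hα2 (2 * n) (by omega) (2 * i + 1) (by omega)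
    have ey := gam_succ α (2 * n) (by omega) (2 * i) y1
    have ez := gam_succ α (2 * n) (by omega) (2 * i + 1) z1
    have ev := gam_succ α n hn i (lt_of_lt_of_le y1 ih)
    rw [show 2 * (i + 1) + 1 = 2 * i + 1 + 2 by ring, show i + 1 + 1 = i + 2 by ring, ez, ev]
    rw [show 2 * i + 1 + 1 = 2 * i + 2 by ring] at z1 ⊢
    generalize gam α (2 * n) (2 * i + 2) = z at *
    generalize gam α (2 * n) (2 * i + 1) = y at *
    generalize gam α n (i + 1) = v at *
    have ec : (1 - α) / (2 * (n : ℝ)) = 2 * ((1 - α) / (2 * ((2 * n : ℕ) : ℝ))) := by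
      push_cast; field_simp
    have hc : 0 < (1 - α) / (2 * ((2 * n : ℕ) : ℝ)) :=
      div_pos (by linarith) (by positivity)
    rw [ec]
    generalize (1 - α) / (2 * ((2 * n : ℕ) : ℝ)) = c at *
    have hzy : z ≤ y := by
      have : 0 ≤ c * y / (y - α) :=
        div_nonneg (mul_nonneg hc.le (by linarith)) (by linarith)
      linarith
    have p1 := phi_anti α c z y h0 hc z1 hzy
    have p2 := phi_anti α c y v h0 hc y1 ih
    have p3 : 2 * c * v / (v - α) = 2 * (c * v / (v - α)) := by ring
    linarith

/-- Doubling: if `γ_{2n}(2n)` exceeds the stated threshold, then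
`γ_{2n}(2n) ≤ γ_n(n)`. -/
theorem gam_doubling_final (α : ℝ) (hα1 : 1 / 4 ≤ α) (hα2 : α ≤ 3 / 11)
    (n : ℕ) (hn : 1 ≤ n)
    (h : α + (1 - α + Real.sqrt (16 * n * α * (1 - α) + (1 - α) ^ 2)) / (8 * n)
      < gam α (2 * n) (2 * n)) :
    gam α (2 * n) (2 * n) ≤ gam α n n := by
  have h0 : 0 < α := by linarith
  obtain ⟨k, rfl⟩ : ∃ k, n = k + 1 := ⟨n - 1, by omega⟩
  have hcmp := gam_cmp α h0 hα2 (k + 1) hn k (by omega)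
  obtain ⟨y1, -, -⟩ := gam_inv α h0 hα2 (2 * (k + 1)) (by omega) (2 * k) (by omega)
  have ey := gam_succ α (2 * (k + 1)) (by omega) (2 * k) y1
  have : 0 ≤ (1 - α) / (2 * ((2 * (k + 1) : ℕ) : ℝ)) * gam α (2 * (k + 1)) (2 * k + 1) /
      (gam α (2 * (k + 1)) (2 * k + 1) - α) :=
    div_nonneg (mul_nonneg (div_nonneg (by linarith) (by positivity)) (by linarith)) (by linarith)
  have e : gam α (2 * (k + 1)) (2 * (k + 1)) = gam α (2 * (k + 1)) (2 * k + 2) := rfl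
  rw [e]
  linarith
end

section
/- Let α ∈ [3/11, 1/3), let ε > 0, let ρ satisfy α + ε ≤ ρ ≤ 3α and ρ < 1, and let β satisfy ρ ≤ β ≤ 1 and 3α + ε ≤ β. Let n, n_0, d be integers with n ≥ 1, n_0 ≥ 1 and 1 ≤ d ≤ n. Define the sequence γ : ℕ → ℝ by γ(1) = β and, for k ≥ 1: if γ(k) − ε ≥ 3α then γ(k+1) = (1 − 2(1−3α)/((γ(k) − ε − 12α + 3)·n))·γ(k), and if γ(k) − ε < 3α then γ(k+1) = (1 − 4α/(3(γ(k) − ε − α)·n))·γ(k). If 3(3α − ρ − α·ln(3α) + α·ln ρ)/(4α) + (1 − 3α + (12α−3)·ln(3α))/(2(1−3α)) ≥ n_0/n + ε·(1/α + (1 − ln(3α))/(2(1−3α))) + (1 − β + (12α−3)·ln β)/(2(1−3α)) + d(1 − ρ/β)/n + 3((3α+ε)/β − ρ/β + 1/d)/(2·(ρ/β)·(ρd/β + 1)) + 3(1 − (3α+ε)/β)/(2·((3α+ε)/β)·((3α+ε)d/β + 1)) + 3β(β/d + 4α)/(4(3α+ε)·α·d) + (β − ε − 12α + 3)/(2d(1−3α)),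 then γ(n_0) ≥ ρ. -/
/-- The two-regime recursively defined sequence: `γ 1 = β` and, for `k ≥ 1`,
if `γ k - ε ≥ 3α` then `γ (k+1) = (1 - 2(1-3α)/((γ k - ε - 12α + 3)·n))·γ k`,
and if `γ k - ε < 3α` then `γ (k+1) = (1 - 4α/(3(γ k - ε - α)·n))·γ k`. -/
noncomputable def gam2 (α ε β : ℝ) (n : ℕ) : ℕ → ℝ
  | 0 => β
  | 1 => β
  | i + 2 =>
      if 3 * α ≤ gam2 α ε β n (i + 1) - ε then
        (1 - 2 * (1 - 3 * α) / ((gam2 α ε β n (i + 1) - ε - 12 * α + 3) * n)) *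
          gam2 α ε β n (i + 1)
      else
        (1 - 4 * α / (3 * (gam2 α ε β n (i + 1) - ε - α) * n)) * gam2 α ε β n (i + 1)

lemma gam2_aux_log (c x y : ℝ) (hc : 0 ≤ c) (hy : 0 < y) (hx : 0 < x) :
    (x - c * Real.log x) - (y - c * Real.log y) ≤ (x - c) / x * (x - y) := by
  have h := Real.log_le_sub_one_of_pos (div_pos hy hx)
  rw [Real.log_div hy.ne' hx.ne'] at h
  have h2 := mul_le_mul_of_nonneg_left h hc
  have h3 : (x - c) / x * (x - y) = (x - y) + c * (y / x - 1) := by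
    field_simp
    ring
  rw [h3]
  nlinarith

/-- Elapsed continuous time for the flow to go from `β` down to `x`. -/
noncomputable def gam2P (α ε β x : ℝ) : ℝ :=
  if 3 * α + ε ≤ x then
    ((β - (12 * α - 3 + ε) * Real.log β) - (x - (12 * α - 3 + ε) * Real.log x))
      / (2 * (1 - 3 * α))
  else
    ((β - (12 * α - 3 + ε) * Real.log β)
      - ((3 * α + ε) - (12 * α - 3 + ε) * Real.log (3 * α + ε))) / (2 * (1 - 3 * α))
    + 3 * (((3 * α + ε) - (α + ε) * Real.log (3 * α + ε))
      - (x - (α + ε) * Real.log x)) / (4 * α)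

/-- Reciprocal speed of the flow. -/
noncomputable def gam2f (α ε x : ℝ) : ℝ :=
  if 3 * α + ε ≤ x then (x - (12 * α - 3 + ε)) / x / (2 * (1 - 3 * α))
  else 3 * ((x - (α + ε)) / x) / (4 * α)

lemma gam2_aux_step (α ε β x y : ℝ) (hα1 : 3 / 11 ≤ α) (hα2 : α < 1 / 3) (hε : 0 < ε)
    (hy : 0 < y) (hyx : y ≤ x) :
    gam2P α ε β y - gam2P α ε β x ≤ gam2f α ε x * (x - y) := by
  have hx : 0 < x := hy.trans_le hyx
  have hk : 0 < 2 * (1 - 3 * α) := by linarith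
  have hk4 : 0 < 4 * α := by linarith
  have hm : 0 < 3 * α + ε := by linarith
  have A : ∀ u v : ℝ, 0 < v → 0 < u →
      ((u - (12 * α - 3 + ε) * Real.log u) - (v - (12 * α - 3 + ε) * Real.log v))
        / (2 * (1 - 3 * α)) ≤ (u - (12 * α - 3 + ε)) / u / (2 * (1 - 3 * α)) * (u - v) := by
    intro u v hv hu
    have := gam2_aux_log (12 * α - 3 + ε) u v (by linarith) hv hu
    calc _ ≤ (u - (12 * α - 3 + ε)) / u * (u - v) / (2 * (1 - 3 * α)) := by gcongr
      _ = _ := by ring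
  have B : ∀ u v : ℝ, 0 < v → 0 < u →
      3 * ((u - (α + ε) * Real.log u) - (v - (α + ε) * Real.log v))
        / (4 * α) ≤ 3 * ((u - (α + ε)) / u) / (4 * α) * (u - v) := by
    intro u v hv hu
    have := gam2_aux_log (α + ε) u v (by linarith) hv hu
    calc _ ≤ 3 * ((u - (α + ε)) / u * (u - v)) / (4 * α) := by gcongr
      _ = _ := by ring
  unfold gam2P gam2f
  by_cases h1 : 3 * α + ε ≤ x
  · by_cases h2 : 3 * α + ε ≤ y
    · simp only [h1, h2, if_true]
      refine le_trans (le_of_eq ?_) (A x y hy hx)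
      ring
    · simp only [h1, h2, if_true, if_false]
      have a := A x (3 * α + ε) hm hx
      have b := B (3 * α + ε) y hy hm
      have e : 3 * ((3 * α + ε - (α + ε)) / (3 * α + ε)) / (4 * α)
          ≤ (x - (12 * α - 3 + ε)) / x / (2 * (1 - 3 * α)) := by
        have e1 : 3 * ((3 * α + ε - (α + ε)) / (3 * α + ε)) / (4 * α)
            = (1 - (12 * α - 3 + ε) / (3 * α + ε)) / (2 * (1 - 3 * α)) := by
          have : 1 - 3 * α ≠ 0 := by linarith
          have : α ≠ 0 := by linarith
          field_simp
          ring
        have e2 : (x - (12 * α - 3 + ε)) / x = 1 - (12 * α - 3 + ε) / x := by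
          field_simp
        rw [e1, e2]
        have : 0 ≤ 12 * α - 3 + ε := by linarith
        gcongr
      have e' := mul_le_mul_of_nonneg_right e (by linarith : 0 ≤ 3 * α + ε - y)
      have := add_le_add a (b.trans e')
      refine le_trans (le_of_eq ?_) (this.trans (le_of_eq ?_)) <;> ring
  · have h2 : ¬ 3 * α + ε ≤ y := by linarith
    simp only [h1, h2, if_false]
    refine le_trans (le_of_eq ?_) (B x y hy hx)
    ring

lemma gam2_aux_next (K g x N : ℝ) (hK : 0 < K) (hg : 0 ≤ g) (hx : 0 < x) (hN : 0 < N) :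
    (1 - K / (g * N)) * x ≤ x ∧ g / x / K * (x - (1 - K / (g * N)) * x) ≤ 1 / N := by
  constructor
  · have : 0 ≤ K / (g * N) * x := by positivity
    linarith
  · rcases hg.eq_or_lt with h | h
    · rw [← h]; simp; positivity
    · apply le_of_eq
      field_simp
      ring

lemma gam2_aux_final (α ε ρ β N : ℝ)
    (hα1 : 3 / 11 ≤ α) (hα2 : α < 1 / 3) (hε : 0 < ε)
    (hρ1 : α + ε ≤ ρ) (hρ3 : ρ ≤ 3 * α)
    (hβ2 : β ≤ 1) (hβ3 : 3 * α + ε ≤ β)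
    (h : N + ε * (1 / α + (1 - Real.log (3 * α)) / (2 * (1 - 3 * α)))
        + (1 - β + (12 * α - 3) * Real.log β) / (2 * (1 - 3 * α))
      ≤ 3 * (3 * α - ρ - α * Real.log (3 * α) + α * Real.log ρ) / (4 * α)
        + (1 - 3 * α + (12 * α - 3) * Real.log (3 * α)) / (2 * (1 - 3 * α))) :
    N ≤ gam2P α ε β ρ := by
  have hk : 0 < 2 * (1 - 3 * α) := by linarith
  have hα : 0 < α := by linarith
  have hρ : 0 < ρ := by linarith
  have hm : 0 < 3 * α + ε := by linarith
  have h2 : ¬ 3 * α + ε ≤ ρ := by linarith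
  have hb : Real.log β ≤ 0 := Real.log_nonpos (by linarith) hβ2
  have hL0 : Real.log (3 * α) ≤ Real.log (3 * α + ε) :=
    Real.log_le_log (by linarith) (by linarith)
  have hL1 : Real.log (3 * α + ε) - Real.log (3 * α) ≤ ε / (3 * α) := by
    rw [← Real.log_div hm.ne' (by positivity)]
    refine (Real.log_le_sub_one_of_pos (by positivity)).trans (le_of_eq ?_)
    field_simp
    ring
  have hL2 : Real.log (3 * α + ε) - Real.log ρ ≤ 2 := by
    rw [← Real.log_div hm.ne' hρ.ne']
    refine (Real.log_le_sub_one_of_pos (by positivity)).trans ?_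
    rw [sub_le_iff_le_add, div_le_iff₀ hρ]
    linarith
  unfold gam2P
  simp only [h2, if_false]
  have p1 : (-(ε * (1 - Real.log (3 * α)))) / (2 * (1 - 3 * α)) ≤
      (-ε + (12 * α - 3) * (Real.log (3 * α + ε) - Real.log (3 * α))
        - ε * (Real.log β - Real.log (3 * α + ε))) / (2 * (1 - 3 * α)) := by
    gcongr
    have := mul_nonneg (by linarith : 0 ≤ 12 * α - 3) (sub_nonneg.2 hL0)
    have := mul_nonneg hε.le (sub_nonneg.2 hL0)
    have := mul_nonneg hε.le (neg_nonneg.2 hb)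
    linarith
  have p2 : -(4 * ε) / (4 * α) ≤
      3 * (ε - α * (Real.log (3 * α + ε) - Real.log (3 * α))
        - ε * (Real.log (3 * α + ε) - Real.log ρ)) / (4 * α) := by
    gcongr
    have a := mul_le_mul_of_nonneg_left hL1 hα.le
    have b := mul_le_mul_of_nonneg_left hL2 hε.le
    have : α * (ε / (3 * α)) = ε / 3 := by field_simp
    linarith
  have e2 : -(4 * ε) / (4 * α) = - (ε * (1 / α)) := by field_simp
  rw [e2] at p2
  have := add_le_add (add_le_add p1 p2) h
  have e3 : 3 * (3 * α + ε - (α + ε) * Real.log (3 * α + ε) - (ρ - (α + ε) * Real.log ρ)) / (4 * α)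
      = 3 * (ε - α * (Real.log (3 * α + ε) - Real.log (3 * α))
        - ε * (Real.log (3 * α + ε) - Real.log ρ)) / (4 * α)
      + 3 * (3 * α - ρ - α * Real.log (3 * α) + α * Real.log ρ) / (4 * α) := by ring
  rw [e3]
  ring_nf at this ⊢
  linarith

/-- If the stated inequality holds, then `γ(n₀) ≥ ρ`. -/
theorem gam2_ge_rho (α ε ρ β : ℝ)
    (hα1 : 3 / 11 ≤ α) (hα2 : α < 1 / 3) (hε : 0 < ε)
    (hρ1 : α + ε ≤ ρ) (hρ3 : ρ ≤ 3 * α) (hρ2 : ρ < 1)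
    (hβ1 : ρ ≤ β) (hβ2 : β ≤ 1) (hβ3 : 3 * α + ε ≤ β)
    (n n0 d : ℕ) (hn : 1 ≤ n) (hn0 : 1 ≤ n0) (hd1 : 1 ≤ d) (hdn : d ≤ n)
    (hineq : (n0 : ℝ) / n
        + ε * (1 / α + (1 - Real.log (3 * α)) / (2 * (1 - 3 * α)))
        + (1 - β + (12 * α - 3) * Real.log β) / (2 * (1 - 3 * α))
        + d * (1 - ρ / β) / n
        + 3 * ((3 * α + ε) / β - ρ / β + 1 / d) / (2 * (ρ / β) * (ρ * d / β + 1))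
        + 3 * (1 - (3 * α + ε) / β) /
            (2 * ((3 * α + ε) / β) * ((3 * α + ε) * d / β + 1))
        + 3 * β * (β / d + 4 * α) / (4 * (3 * α + ε) * α * d)
        + (β - ε - 12 * α + 3) / (2 * d * (1 - 3 * α))
      ≤ 3 * (3 * α - ρ - α * Real.log (3 * α) + α * Real.log ρ) / (4 * α)
        + (1 - 3 * α + (12 * α - 3) * Real.log (3 * α)) / (2 * (1 - 3 * α))) :
    ρ ≤ gam2 α ε β n n0 := by
  have hα : 0 < α := by linarith
  have hk : 0 < 1 - 3 * α := by linarith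
  have hρ : 0 < ρ := by linarith
  have hβ : 0 < β := by linarith
  have hm : 0 < 3 * α + ε := by linarith
  have hN : (0 : ℝ) < n := by exact_mod_cast hn
  have hD : (0 : ℝ) < d := by exact_mod_cast hd1
  have t1 : 0 ≤ d * (1 - ρ / β) / n := by
    have : ρ / β ≤ 1 := (div_le_one hβ).2 hβ1
    have : 0 ≤ 1 - ρ / β := by linarith
    positivity
  have t2 : 0 ≤ 3 * ((3 * α + ε) / β - ρ / β + 1 / d) / (2 * (ρ / β) * (ρ * d / β + 1)) := by
    have : 0 ≤ (3 * α + ε) / β - ρ / β := by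
      rw [← sub_div]
      exact div_nonneg (by linarith) hβ.le
    positivity
  have t3 : 0 ≤ 3 * (1 - (3 * α + ε) / β) /
            (2 * ((3 * α + ε) / β) * ((3 * α + ε) * d / β + 1)) := by
    have : (3 * α + ε) / β ≤ 1 := (div_le_one hβ).2 hβ3
    have : 0 ≤ 1 - (3 * α + ε) / β := by linarith
    positivity
  have t4 : 0 ≤ 3 * β * (β / d + 4 * α) / (4 * (3 * α + ε) * α * d) := by positivity
  have t5 : 0 ≤ (β - ε - 12 * α + 3) / (2 * d * (1 - 3 * α)) := by
    have : 0 ≤ β - ε - 12 * α + 3 := by linarith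
    positivity
  have hfin : (n0 : ℝ) / n ≤ gam2P α ε β ρ :=
    gam2_aux_final α ε ρ β _ hα1 hα2 hε hρ1 hρ3 hβ2 hβ3 (by linarith)
  have key : ∀ k : ℕ, k + 1 ≤ n0 →
      ρ ≤ gam2 α ε β n (k + 1) ∧ gam2P α ε β (gam2 α ε β n (k + 1)) ≤ (k : ℝ) / n := by
    intro k
    induction k with
    | zero =>
      intro _
      have : gam2 α ε β n (0 + 1) = β := by simp [gam2]
      rw [this]
      refine ⟨hβ1, ?_⟩
      simp [gam2P, hβ3]
    | succ k ih =>
      intro hk1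
      obtain ⟨ih1, ih2⟩ := ih (by omega)
      have hrec : gam2 α ε β n (k + 1 + 1) = if 3 * α ≤ gam2 α ε β n (k + 1) - ε then
        (1 - 2 * (1 - 3 * α) / ((gam2 α ε β n (k + 1) - ε - 12 * α + 3) * n)) *
          gam2 α ε β n (k + 1)
        else
        (1 - 4 * α / (3 * (gam2 α ε β n (k + 1) - ε - α) * n)) * gam2 α ε β n (k + 1) := by
        rw [gam2]
      generalize gam2 α ε β n (k + 1 + 1) = x' at *
      generalize gam2 α ε β n (k + 1) = x at *
      have hx : 0 < x := by linarith
      have hstep : x' ≤ x ∧ 0 ≤ gam2f α ε x ∧ gam2f α ε x * (x - x') ≤ 1 / n := by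
        unfold gam2f
        by_cases hc : 3 * α + ε ≤ x
        · rw [if_pos (by linarith)] at hrec
          rw [if_pos hc, hrec]
          have hg : 0 ≤ x - ε - 12 * α + 3 := by linarith
          have := gam2_aux_next (2 * (1 - 3 * α)) (x - ε - 12 * α + 3) x n (by linarith)
            hg hx hN
          have e : x - (12 * α - 3 + ε) = x - ε - 12 * α + 3 := by ring
          rw [e]
          exact ⟨this.1, by positivity, this.2⟩
        · rw [if_neg (by linarith)] at hrec
          rw [if_neg hc, hrec]
          have hg : 0 ≤ 3 * (x - ε - α) := by linarith
          have := gam2_aux_next (4 * α) (3 * (x - ε - α)) x n (by linarith)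
            hg hx hN
          have e : 3 * ((x - (α + ε)) / x) = 3 * (x - ε - α) / x := by ring
          rw [e]
          exact ⟨this.1, by positivity, this.2⟩
      obtain ⟨s1, s2, s3⟩ := hstep
      have hP : ∀ y, ρ ≤ y → x' ≤ y → y ≤ x → gam2P α ε β y ≤ ((k + 1 : ℕ) : ℝ) / n := by
        intro y h1 h2 h3
        have a := gam2_aux_step α ε β x y hα1 hα2 hε (by linarith) h3
        have b := mul_le_mul_of_nonneg_left (by linarith : x - y ≤ x - x') s2
        have e : ((k + 1 : ℕ) : ℝ) / n = k / n + 1 / n := by push_cast; ring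
        rw [e]
        linarith
      have hge : ρ ≤ x' := by
        by_contra! hlt
        have a := hfin.trans (hP ρ le_rfl hlt.le ih1)
        rw [div_le_div_iff_of_pos_right hN] at a
        have : n0 ≤ k + 1 := by exact_mod_cast a
        omega
      exact ⟨hge, hP x' hge le_rfl s1⟩
  obtain ⟨k, rfl⟩ : ∃ k, n0 = k + 1 := ⟨n0 - 1, by omega⟩
  exact (key k le_rfl).1
end

section
/- Let ρ be a real number with 3/11 < ρ < 1/3 satisfying 2(12ρ − 3)·ln(3ρ) = (1 − 3ρ)(3·ln 3 − 4), and let α ∈ [3/11, ρ). Let x be a constant with 0 < x < ρ − α, and let (ε_n)_{n≥1} and (δ_n)_{n≥1} be sequences of nonnegative real numbers converging to 0. For each integer n ≥ 1 define the sequence γ_n : ℕ → ℝ by γ_n(1) = 1 − δ_n and, for k ≥ 1: if γ_n(k) − ε_n ≥ 3α then γ_n(k+1) = (1 − 2(1−3α)/((γ_n(k) − ε_n − 12α + 3)·n))·γ_n(k), and if γ_n(k) − ε_n < 3α then γ_n(k+1) = (1 − 4α/(3(γ_n(k) − ε_n − α)·n))·γ_n(k). Then there exists a natural number n_x such that for all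 n ≥ n_x and all integers n_0 with 1 ≤ n_0 ≤ n, it holds that γ_n(n_0) − ε_n ≥ α + x. -/
set_option maxHeartbeats 1000000 in
/-- The total time of the limiting flow down to `α + x` exceeds `1`. -/
lemma margin_aux (ρ α x : ℝ)
    (hρ2 : ρ < 1 / 3)
    (hρeq : 2 * (12 * ρ - 3) * Real.log (3 * ρ) = (1 - 3 * ρ) * (3 * Real.log 3 - 4))
    (hα1 : 3 / 11 ≤ α) (hα2 : α < ρ) (hx0 : 0 < x) (hx : x < ρ - α) :
    1 < 1 / (2 * (1 - 3 * α)) * ((1 - (12 * α - 3) * Real.log 1)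
          - (3 * α - (12 * α - 3) * Real.log (3 * α)))
        + 3 / (4 * α) * ((3 * α - α * Real.log (3 * α)) - (α + x - α * Real.log (α + x))) := by
  have hα0 : 0 < α := by linarith
  have hρ0 : 0 < ρ := by linarith
  have hs : 0 < 1 - 3 * α := by linarith
  have ht : 0 < 1 - 3 * ρ := by linarith
  have hd : 0 < ρ - α := by linarith
  obtain ⟨M, hM⟩ : ∃ M, M = -Real.log (3 * ρ) / (1 - 3 * ρ) := ⟨_, rfl⟩
  obtain ⟨L, hL⟩ : ∃ L, L = -Real.log (3 * α) / (1 - 3 * α) := ⟨_, rfl⟩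
  have hm : Real.log (3 * ρ) = -(M * (1 - 3 * ρ)) := by rw [hM]; field_simp
  have hl : Real.log (3 * α) = -(L * (1 - 3 * α)) := by rw [hL]; field_simp
  have hM1 : 1 ≤ M := by
    have h := Real.log_le_sub_one_of_pos (show 0 < 3 * ρ by linarith)
    rw [hM, le_div_iff₀ ht]; linarith
  have hw : ∃ w, w = (ρ - α) / α := ⟨_, rfl⟩
  obtain ⟨w, hw⟩ := hw
  have hwα : ρ - α = w * α := by rw [hw]; field_simp
  have hw0 : 0 < w := by rw [hw]; positivity
  have F1 : -Real.log (3 * α) ≤ -Real.log (3 * ρ) + w := by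
    have h := Real.log_le_sub_one_of_pos (show 0 < (3 * ρ) / (3 * α) by positivity)
    rw [Real.log_div (by positivity) (by positivity)] at h
    have : (3 * ρ) / (3 * α) - 1 = w := by rw [hw]; field_simp
    linarith
  have hLM : L ≤ M + w := by
    rw [hm, hl] at F1
    have hρw : ρ = α + w * α := by linarith
    have : L * (1 - 3 * α) ≤ (M + w) * (1 - 3 * α) := by
      rw [hρw] at F1
      nlinarith [mul_nonneg (mul_pos hw0 hα0).le (sub_nonneg.2 hM1)]
    exact le_of_mul_le_mul_right this hs
  have hMeq : (12 * ρ - 3) * M = 2 - 3 / 2 * Real.log 3 := by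
    rw [hm] at hρeq
    have : (1 - 3 * ρ) * ((12 * ρ - 3) * M) = (1 - 3 * ρ) * (2 - 3 / 2 * Real.log 3) := by
      linarith
    exact mul_left_cancel₀ ht.ne' this
  obtain ⟨v, hv⟩ : ∃ v, v = x / α := ⟨_, rfl⟩
  have hxv : x = v * α := by rw [hv]; field_simp
  have hv0 : 0 < v := by rw [hv]; positivity
  have hvw : v < w := by rw [hv, hw]; gcongr
  have hw1 : w < 2 / 9 := by
    rw [hw, div_lt_iff₀ hα0]; linarith
  have F3 : v - v ^ 2 ≤ Real.log (1 + v) := by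
    have h := Real.one_sub_inv_le_log_of_pos (show 0 < 1 + v by linarith)
    have : v - v ^ 2 ≤ 1 - (1 + v)⁻¹ := by
      have : 1 - (1 + v)⁻¹ = v / (1 + v) := by field_simp; ring
      rw [this, le_div_iff₀ (by linarith)]
      nlinarith [pow_pos hv0 3]
    linarith
  have hlog3 : Real.log (3 * α) = Real.log 3 + Real.log α :=
    Real.log_mul (by norm_num) hα0.ne'
  have hlogx : Real.log (α + x) = Real.log α + Real.log (1 + v) := by
    rw [← Real.log_mul hα0.ne' (by linarith)]; congr 1; rw [hxv]; ring
  have e1 : 1 / (2 * (1 - 3 * α)) * ((1 - (12 * α - 3) * Real.log 1)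
          - (3 * α - (12 * α - 3) * Real.log (3 * α))) = 1 / 2 - (12 * α - 3) / 2 * L := by
    rw [hl, Real.log_one]; field_simp; ring
  have e2 : 3 / (4 * α) * ((3 * α - α * Real.log (3 * α)) - (α + x - α * Real.log (α + x)))
      = 3 / 4 * (2 - v - Real.log 3 + Real.log (1 + v)) := by
    rw [hlog3, hlogx, hxv]; field_simp; ring
  rw [e1, e2]
  have h1 : (12 * α - 3) / 2 * L ≤ (12 * α - 3) / 2 * (M + w) :=
    mul_le_mul_of_nonneg_left hLM (by linarith)
  have h2 : (12 * ρ - 3) / 2 * M - (12 * α - 3) / 2 * M = 6 * (w * α) * M := by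
    rw [← hwα]; ring
  have h3 : 6 * (w * α) * 1 ≤ 6 * (w * α) * M :=
    mul_le_mul_of_nonneg_left hM1 (by positivity)
  have h4 : (12 * α - 3) / 2 * w ≤ 1 / 2 * w :=
    mul_le_mul_of_nonneg_right (by linarith) hw0.le
  have h5 : v ^ 2 ≤ w * (2 / 9) := by nlinarith
  have h6 : 3 / 11 * w ≤ α * w := mul_le_mul_of_nonneg_right hα1 hw0.le
  linarith

/-- Tangent inequality for `h ↦ h - c log h`. -/
lemma tangent_aux (c h k : ℝ) (hc : 0 ≤ c) (hh : 0 < h) (hk : 0 < k) :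
    (h - c * Real.log h) - (k - c * Real.log k) ≤ (1 - c / h) * (h - k) := by
  have h1 := Real.log_le_sub_one_of_pos (show 0 < k / h by positivity)
  rw [Real.log_div hk.ne' hh.ne'] at h1
  have h2 := mul_le_mul_of_nonneg_left h1 hc
  have h3 : (1 - c / h) * (h - k) = h - k + c * (k / h - 1) := by field_simp; ring
  rw [h3]; linarith

/-- The (negative) time function. -/
noncomputable def psiT (α h : ℝ) : ℝ :=
  if 3 * α ≤ h then
    1 / (2 * (1 - 3 * α)) * ((h - (12 * α - 3) * Real.log h)
      - (3 * α - (12 * α - 3) * Real.log (3 * α)))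
  else 3 / (4 * α) * ((h - α * Real.log h) - (3 * α - α * Real.log (3 * α)))

/-- The rate. -/
noncomputable def rateT (α h : ℝ) : ℝ :=
  if 3 * α ≤ h then 2 * (1 - 3 * α) / (h - 12 * α + 3) else 4 * α / (3 * (h - α))

lemma psiT_tangent (α h k : ℝ) (hα1 : 3 / 11 ≤ α) (hα2 : α < 1 / 3) (hh : α < h) (hk : 0 < k)
    (hkh : k ≤ h) : psiT α h - psiT α k ≤ 1 / (rateT α h * h) * (h - k) := by
  have hα0 : 0 < α := by linarith
  have hh0 : 0 < h := by linarith
  have hs : 0 < 1 - 3 * α := by linarith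
  have hc : 0 ≤ 12 * α - 3 := by linarith
  unfold psiT rateT
  by_cases h1 : 3 * α ≤ h
  · have hden : 0 < h - 12 * α + 3 := by linarith
    have e : 1 / (2 * (1 - 3 * α) / (h - 12 * α + 3) * h)
        = 1 / (2 * (1 - 3 * α)) * (1 - (12 * α - 3) / h) := by
      field_simp; ring
    rw [if_pos h1, if_pos h1, e]
    have hp : 0 ≤ 1 / (2 * (1 - 3 * α)) := by positivity
    by_cases h2 : 3 * α ≤ k
    · rw [if_pos h2]
      have := mul_le_mul_of_nonneg_left (tangent_aux _ h k hc hh0 hk) hp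
      linarith
    · rw [if_neg h2]
      push Not at h2
      have a1 := mul_le_mul_of_nonneg_left
        (tangent_aux _ h (3 * α) hc hh0 (by positivity)) hp
      have a2 := mul_le_mul_of_nonneg_left
        (tangent_aux α (3 * α) k hα0.le (by positivity) hk)
        (show 0 ≤ 3 / (4 * α) by positivity)
      have a3 : 3 / (4 * α) * ((1 - α / (3 * α)) * (3 * α - k))
          = 1 / (2 * (1 - 3 * α)) * (1 - (12 * α - 3) / (3 * α)) * (3 * α - k) := by
        field_simp; ring
      have a4 : (12 * α - 3) / h ≤ (12 * α - 3) / (3 * α) := by gcongr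
      have a5 : 1 / (2 * (1 - 3 * α)) * (1 - (12 * α - 3) / (3 * α)) * (3 * α - k)
          ≤ 1 / (2 * (1 - 3 * α)) * (1 - (12 * α - 3) / h) * (3 * α - k) := by
        apply mul_le_mul_of_nonneg_right _ (by linarith)
        apply mul_le_mul_of_nonneg_left _ hp
        linarith
      linarith
  · have h2 : ¬ 3 * α ≤ k := fun h' => h1 (h'.trans hkh)
    rw [if_neg h1, if_neg h2, if_neg h1]
    have hden : 0 < h - α := by linarith
    have e : 1 / (4 * α / (3 * (h - α)) * h) = 3 / (4 * α) * (1 - α / h) := by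
      field_simp
    rw [e]
    have := mul_le_mul_of_nonneg_left (tangent_aux α h k hα0.le hh0 hk)
        (show 0 ≤ 3 / (4 * α) by positivity)
    linarith

lemma gam2_step (α ε β : ℝ) (n k : ℕ) (hk : 1 ≤ k) :
    gam2 α ε β n (k + 1) =
      (1 - rateT α (gam2 α ε β n k - ε) / n) * gam2 α ε β n k := by
  obtain ⟨i, rfl⟩ : ∃ i, k = i + 1 := ⟨k - 1, by omega⟩
  rw [gam2]
  unfold rateT
  split_ifs <;> rw [div_div]

lemma rateT_bounds (α h x : ℝ) (hα1 : 3 / 11 ≤ α) (hα2 : α < 1 / 3) (hx0 : 0 < x)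
    (hh : α + x ≤ h) : 0 < rateT α h ∧ rateT α h ≤ 1 + 1 / x := by
  have hs : 0 < 1 - 3 * α := by linarith
  have hα0 : 0 < α := by linarith
  have hx' : 0 < 1 / x := by positivity
  unfold rateT
  split_ifs with h1
  · have hden : 0 < h - 12 * α + 3 := by linarith
    refine ⟨by positivity, ?_⟩
    have : 2 * (1 - 3 * α) / (h - 12 * α + 3) ≤ 1 := by
      rw [div_le_one hden]; linarith
    linarith
  · have hden : 0 < h - α := by linarith
    refine ⟨by positivity, ?_⟩
    have : 4 * α / (3 * (h - α)) ≤ 1 / x := by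
      rw [div_le_div_iff₀ (by positivity) hx0]
      nlinarith
    linarith

lemma main_aux (α x ε β : ℝ) (n : ℕ) (hα1 : 3 / 11 ≤ α) (hα2 : α < 1 / 3) (hx0 : 0 < x)
    (hx2 : x < 2 * α) (hε : 0 ≤ ε) (hβ : β ≤ 1) (hn : (1 + 1 / x) / x ≤ n)
    (hstart : 3 * α ≤ β - ε)
    (hmar : psiT α (α + x) < psiT α (β - ε) - (1 + ε / α)) :
    ∀ k : ℕ, 1 ≤ k → k ≤ n → α + x ≤ gam2 α ε β n k - ε ∧ gam2 α ε β n k ≤ 1 ∧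
      psiT α (β - ε) - (k - 1) * ((1 + ε / α) / n) ≤ psiT α (gam2 α ε β n k - ε) := by
  have hα0 : 0 < α := by linarith
  have hn0 : (0 : ℝ) < n := lt_of_lt_of_le (by positivity) hn
  intro k hk
  induction k, hk using Nat.le_induction with
  | base => intro _; simp only [gam2]; refine ⟨by linarith, hβ, by simp⟩
  | succ k hk ih =>
    intro hkn
    obtain ⟨i1, i2, i3⟩ := ih (by omega)
    rw [gam2_step _ _ _ _ _ hk]
    set g := gam2 α ε β n k with hg
    obtain ⟨r0, r1⟩ := rateT_bounds α (g - ε) x hα1 hα2 hx0 i1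
    have hg0 : 0 < g := by linarith
    have hstep : rateT α (g - ε) / n ≤ x := by
      rw [div_le_iff₀ hn0]
      rw [div_le_iff₀ hx0] at hn
      linarith
    have hr : 0 < rateT α (g - ε) / n := by positivity
    have hdec : (1 - rateT α (g - ε) / n) * g - ε ≤ g - ε := by nlinarith
    have hlow : α ≤ (1 - rateT α (g - ε) / n) * g - ε := by nlinarith
    have ht := psiT_tangent α (g - ε) ((1 - rateT α (g - ε) / n) * g - ε) hα1 hα2
      (by linarith) (by linarith) hdec
    have hge : 0 < g - ε := by linarith
    have e : 1 / (rateT α (g - ε) * (g - ε)) *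
        (g - ε - ((1 - rateT α (g - ε) / n) * g - ε)) = (1 + ε / (g - ε)) / n := by
      generalize rateT α (g - ε) = r at *
      have : r ≠ 0 := r0.ne'
      have : g - ε ≠ 0 := hge.ne'
      field_simp
      ring
    rw [e] at ht
    have hle : (1 + ε / (g - ε)) / n ≤ (1 + ε / α) / n := by
      have : ε / (g - ε) ≤ ε / α := by gcongr; linarith
      gcongr
    have hpsi : psiT α (β - ε) - ((k + 1 : ℕ) - 1) * ((1 + ε / α) / n) ≤
        psiT α ((1 - rateT α (g - ε) / n) * g - ε) := by
      push_cast
      linarith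
    refine ⟨?_, by linarith, hpsi⟩
    by_contra hcon
    push Not at hcon
    set h' := (1 - rateT α (g - ε) / n) * g - ε with hh'
    have hkn' : ((k + 1 : ℕ) - 1 : ℝ) * ((1 + ε / α) / n) ≤ 1 + ε / α := by
      rw [mul_div_assoc', div_le_iff₀ hn0, mul_comm]
      apply mul_le_mul_of_nonneg_left _ (by positivity)
      have : ((k + 1 : ℕ) : ℝ) ≤ n := by exact_mod_cast hkn
      linarith
    have hlt : psiT α (α + x) < psiT α h' := by linarith
    unfold psiT at hlt
    rw [if_neg (by linarith), if_neg (by linarith)] at hlt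
    have hlt' := lt_of_mul_lt_mul_left hlt (show 0 ≤ 3 / (4 * α) by positivity)
    have h0 : 0 < h' := by linarith
    have ta := tangent_aux α h' (α + x) hα0.le h0 (by linarith)
    have : α / h' ≤ 1 := by rw [div_le_one h0]; exact hlow
    nlinarith

/-- For `ρ ∈ (3/11, 1/3)` solving `2(12ρ-3)·ln(3ρ) = (1-3ρ)(3·ln 3 - 4)`,
`α ∈ [3/11, ρ)`, a constant `0 < x < ρ - α` and nonnegative null sequences `ε_n, δ_n`,
there is `n_x` such that for all `n ≥ n_x` and all `1 ≤ n₀ ≤ n` one has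
`γ_n(n₀) - ε_n ≥ α + x`, where `γ_n` starts at `1 - δ_n` and uses error `ε_n`. -/
theorem gam2_eventually_ge_with_errors (ρ α : ℝ)
    (hρ1 : 3 / 11 < ρ) (hρ2 : ρ < 1 / 3)
    (hρeq : 2 * (12 * ρ - 3) * Real.log (3 * ρ) = (1 - 3 * ρ) * (3 * Real.log 3 - 4))
    (hα1 : 3 / 11 ≤ α) (hα2 : α < ρ)
    (x : ℝ) (hx0 : 0 < x) (hx : x < ρ - α)
    (ε δ : ℕ → ℝ) (hε0 : ∀ n, 0 ≤ ε n) (hδ0 : ∀ n, 0 ≤ δ n)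
    (hεlim : Filter.Tendsto ε Filter.atTop (nhds 0))
    (hδlim : Filter.Tendsto δ Filter.atTop (nhds 0)) :
    ∃ nx : ℕ, ∀ n : ℕ, nx ≤ n → ∀ n0 : ℕ, 1 ≤ n0 → n0 ≤ n →
      α + x ≤ gam2 α (ε n) (1 - δ n) n n0 - ε n := by
  have hmar := margin_aux ρ α x hρ2 hρeq hα1 hα2 hx0 hx
  have hlim1 : Filter.Tendsto (fun n => 1 - δ n - ε n) Filter.atTop (nhds 1) := by
    simpa using (hδlim.const_sub 1).sub hεlim
  have hev1 : ∀ᶠ n in Filter.atTop, 3 * α < 1 - δ n - ε n :=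
    hlim1.eventually_const_lt (by linarith)
  have hlog : Filter.Tendsto (fun n => Real.log (1 - δ n - ε n)) Filter.atTop
      (nhds (Real.log 1)) := hlim1.log one_ne_zero
  have hlim2 : Filter.Tendsto (fun n => 1 / (2 * (1 - 3 * α)) *
      (((1 - δ n - ε n) - (12 * α - 3) * Real.log (1 - δ n - ε n))
        - (3 * α - (12 * α - 3) * Real.log (3 * α))) - (1 + ε n / α)) Filter.atTop
      (nhds (1 / (2 * (1 - 3 * α)) * ((1 - (12 * α - 3) * Real.log 1)
        - (3 * α - (12 * α - 3) * Real.log (3 * α))) - (1 + 0 / α))) :=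
    (((hlim1.sub (hlog.const_mul _)).sub_const _).const_mul _).sub
      ((hεlim.div_const α).const_add 1)
  have hev2 := hlim2.eventually_const_lt (u := psiT α (α + x)) (by
    unfold psiT
    rw [if_neg (by linarith), zero_div]
    linarith)
  have hev3 : ∀ᶠ n : ℕ in Filter.atTop, (1 + 1 / x) / x ≤ (n : ℝ) :=
    tendsto_natCast_atTop_atTop.eventually_ge_atTop _
  obtain ⟨N, hN⟩ := Filter.eventually_atTop.1 (hev1.and (hev2.and hev3))
  refine ⟨N, fun n hn n0 h1 h2 => ?_⟩
  obtain ⟨a, b, c⟩ := hN n hn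
  refine (main_aux α x (ε n) (1 - δ n) n hα1 (by linarith) hx0 (by linarith) (hε0 n)
    (by linarith [hδ0 n]) c a.le ?_ n0 h1 h2).1
  rw [show psiT α (1 - δ n - ε n) = _ from if_pos a.le]
  exact b
end
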